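/- For the stochastic capacity expansion planning problem on a scenario tree 𝒯 with resources i = 1,…,I, let {y_n^{MLP}}_{n∈𝒯} be the optimal capacity allocation decisions of the linear programming relaxation of the multi-stage version of the problem, and set δ_{in} = [A_n y_n^{MLP}]_i for each resource i and node n. Then for any vector of revision times t* = (t_1*,…,t_I*), V^{ATS}(t*) − V^{MS} ≤ Σ_{i=1}^I ( v_i^R(t_i*) − v_i^M + max_{n ∈ 𝒯_i(t_i*)} { ⌈δ_{in}⌉ − δ_{in} } · a_{i1} ), where v_i^M and v_i^R(t_i*) are the optimal values of the LP relaxations of the single-resource multi-stage and adaptive two-stage problems, respectively, with right-hand-side demands δ_{in}, and a_{i1} is the first-stage unit acquisition cost of resource i. -/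

import Mathlib

open scoped Classical

noncomputable section

/-- A scenario tree with `T` stages over a finite node type: a finite rooted tree whose
nodes are partitioned into stages `1, …, T` (the root being the unique stage-1 node),
equipped with strictly positive node probabilities summing to one within each stage and
with each internal node's probability equal to the sum of its children's probabilities. -/
structure ScenarioTree (T : ℕ) (Node : Type) [Fintype Node] [DecidableEq Node] where
  root : Node
  parent : Node → Node
  stage : Node → ℕ
  stage_root : stage root = 1
  stage_pos : ∀ n, 1 ≤ stage n
  stage_le : ∀ n, stage n ≤ T
  root_unique : ∀ n, stage n = 1 → n = root
  parent_root : parent root = root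
  parent_stage : ∀ n, n ≠ root → stage (parent n) + 1 = stage n
  reaches_root : ∀ n, ∃ k : ℕ, parent^[k] n = root
  prob : Node → ℝ
  prob_pos : ∀ n, 0 < prob n
  prob_sum_stage : ∀ t, 1 ≤ t → t ≤ T →
    ∑ n ∈ Finset.univ.filter (fun n => stage n = t), prob n = 1
  prob_children : ∀ n, stage n < T →
    prob n = ∑ m ∈ Finset.univ.filter (fun m => m ≠ root ∧ parent m = n), prob m

namespace ScenarioTree

variable {T : ℕ} {Node : Type} [Fintype Node] [DecidableEq Node]

/-- `m` lies on the unique path from the root to `n` (i.e. `m` is an ancestor of `n`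
or `n` itself); equivalently, `n` belongs to the subtree `𝒯(m)` rooted at `m`. -/
def onPath (tr : ScenarioTree T Node) (m n : Node) : Prop :=
  ∃ k : ℕ, tr.parent^[k] n = m

/-- `P(n)`: the set of nodes on the unique path from the root to `n` (inclusive). -/
def pathSet (tr : ScenarioTree T Node) (n : Node) : Finset Node :=
  Finset.univ.filter fun m => tr.onPath m n

/-- `S_t`: the set of nodes in stage `t`. -/
def stageSet (tr : ScenarioTree T Node) (t : ℕ) : Finset Node :=
  Finset.univ.filter fun n => tr.stage n = t

/-- Objective `∑_{n ∈ 𝒯} p_n a_n x_n` of the single-resource capacity expansion LP. -/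
def lpObj (tr : ScenarioTree T Node) (a x : Node → ℝ) : ℝ :=
  ∑ n, tr.prob n * a n * x n

/-- Feasibility for the single-resource capacity expansion LP:
`x ≥ 0` and `∑_{m ∈ P(n)} x_m ≥ δ_n` for all nodes `n`. -/
def lpFeas (tr : ScenarioTree T Node) (δ x : Node → ℝ) : Prop :=
  (∀ n, 0 ≤ x n) ∧ ∀ n, δ n ≤ ∑ m ∈ tr.pathSet n, x m

/-- Two-stage constraint: `x_m = x_n` for all `m, n` in the same stage. -/
def twoStageConstr (tr : ScenarioTree T Node) (x : Node → ℝ) : Prop :=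
  ∀ m n, tr.stage m = tr.stage n → x m = x n

/-- Adaptive two-stage constraint with revision time `t*`: `x_m = x_n` for all
`m, n ∈ S_t` with `t < t*`, and `x_m = x_n` for all `m, n ∈ S_t ∩ 𝒯(j)` for each
`j ∈ S_{t*}` and each `t ≥ t*`. -/
def adaptiveConstr (tr : ScenarioTree T Node) (tstar : ℕ) (x : Node → ℝ) : Prop :=
  (∀ m n, tr.stage m = tr.stage n → tr.stage m < tstar → x m = x n) ∧
  (∀ j, tr.stage j = tstar → ∀ m n, tr.onPath j m → tr.onPath j n →
    tr.stage m = tr.stage n → x m = x n)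

/-- `v^M`: optimal value of the multi-stage LP. -/
def vM (tr : ScenarioTree T Node) (a δ : Node → ℝ) : ℝ :=
  sInf (tr.lpObj a '' {x | tr.lpFeas δ x})

/-- `v^T`: optimal value of the two-stage LP. -/
def vT (tr : ScenarioTree T Node) (a δ : Node → ℝ) : ℝ :=
  sInf (tr.lpObj a '' {x | tr.lpFeas δ x ∧ tr.twoStageConstr x})

/-- `v^R(t*)`: optimal value of the adaptive two-stage LP with revision time `t*`. -/
def vR (tr : ScenarioTree T Node) (a δ : Node → ℝ) (tstar : ℕ) : ℝ :=
  sInf (tr.lpObj a '' {x | tr.lpFeas δ x ∧ tr.adaptiveConstr tstar x})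

/-- `a_* = min_{n∈𝒯} a_n`. -/
def aMin (tr : ScenarioTree T Node) (a : Node → ℝ) : ℝ := sInf (Set.range a)

/-- `a^* = max_{n∈𝒯} a_n`. -/
def aMax (tr : ScenarioTree T Node) (a : Node → ℝ) : ℝ := sSup (Set.range a)

/-- `δ* = max_{n∈𝒯} δ_n`. -/
def deltaMax (tr : ScenarioTree T Node) (δ : Node → ℝ) : ℝ := sSup (Set.range δ)

/-- `a̲^−(t*) = min{a_n : t_n < t*}`. -/
def aMinusLo (tr : ScenarioTree T Node) (a : Node → ℝ) (tstar : ℕ) : ℝ :=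
  sInf (a '' {n | tr.stage n < tstar})

/-- `a̲^+(t*) = min{a_n : t_n ≥ t*}`. -/
def aPlusLo (tr : ScenarioTree T Node) (a : Node → ℝ) (tstar : ℕ) : ℝ :=
  sInf (a '' {n | tstar ≤ tr.stage n})

/-- `ā^−(t*) = max{a_n : t_n < t*}`. -/
def aMinusHi (tr : ScenarioTree T Node) (a : Node → ℝ) (tstar : ℕ) : ℝ :=
  sSup (a '' {n | tr.stage n < tstar})

/-- `ā^+(t*) = max{a_n : t_n ≥ t*}`. -/
def aPlusHi (tr : ScenarioTree T Node) (a : Node → ℝ) (tstar : ℕ) : ℝ :=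
  sSup (a '' {n | tstar ≤ tr.stage n})

/-- `δ^−(t*) = max_{m ∈ 𝒯(1, t*−1)} δ_m`, the maximum demand before the revision time. -/
def deltaMinus (tr : ScenarioTree T Node) (δ : Node → ℝ) (tstar : ℕ) : ℝ :=
  sSup (δ '' {m | tr.stage m < tstar})

/-- `δ^+(t*) = ∑_{n ∈ S_{t*}} p_n · max_{m ∈ 𝒯(1, t*−1) ∪ 𝒯(n)} δ_m`. -/
def deltaPlus (tr : ScenarioTree T Node) (δ : Node → ℝ) (tstar : ℕ) : ℝ :=
  ∑ n ∈ tr.stageSet tstar, tr.prob n *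
    sSup (δ '' {m | tr.stage m < tstar ∨ tr.onPath n m})

/-- `δ̄ = ∑_{n ∈ S_T} p_n · max_{m ∈ P(n)} δ_m`, the expected maximum demand over scenarios. -/
def deltaBar (tr : ScenarioTree T Node) (δ : Node → ℝ) : ℝ :=
  ∑ n ∈ tr.stageSet T, tr.prob n * sSup (δ '' {m | tr.onPath m n})

end ScenarioTree


section CapacityExpansion

variable {T : ℕ} {Node : Type} [Fintype Node] [DecidableEq Node]
variable {I J K : ℕ}

/-- Objective `∑_{n∈𝒯} p_n (a_n^⊤ x_n + b_n^⊤ y_n)` of the stochastic capacity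
expansion planning problem (`x`: capacity acquisitions, `y`: capacity allocations). -/
def capObj (tr : ScenarioTree T Node) (a : Node → Fin I → ℝ) (b : Node → Fin J → ℝ)
    (x : Node → Fin I → ℝ) (y : Node → Fin J → ℝ) : ℝ :=
  ∑ n, tr.prob n * ((∑ i, a n i * x n i) + (∑ j, b n j * y n j))

/-- Constraints of the stochastic capacity expansion planning problem (with the
integrality of `x` relaxed): `x ≥ 0`, `y ≥ 0`, `A_n y_n ≤ ∑_{m∈P(n)} x_m`, and
`B_n y_n ≥ d_n` for all nodes `n`. -/
def capFeas (tr : ScenarioTree T Node)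
    (A : Node → Matrix (Fin I) (Fin J) ℝ) (B : Node → Matrix (Fin K) (Fin J) ℝ)
    (dem : Node → Fin K → ℝ)
    (x : Node → Fin I → ℝ) (y : Node → Fin J → ℝ) : Prop :=
  (∀ n i, 0 ≤ x n i) ∧ (∀ n j, 0 ≤ y n j) ∧
  (∀ n (i : Fin I), (A n).mulVec (y n) i ≤ ∑ m ∈ tr.pathSet n, x m i) ∧
  (∀ n (k : Fin K), dem n k ≤ (B n).mulVec (y n) k)

/-- Integrality of the capacity acquisition decisions: `x_n ∈ ℤ_+^I`. -/
def capIntegral {Node : Type} (x : Node → Fin I → ℝ) : Prop :=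
  ∀ n i, ∃ z : ℕ, x n i = (z : ℝ)

/-- `V^{TS}`: optimal value of the two-stage stochastic capacity expansion problem. -/
def VTS (tr : ScenarioTree T Node) (a : Node → Fin I → ℝ) (b : Node → Fin J → ℝ)
    (A : Node → Matrix (Fin I) (Fin J) ℝ) (B : Node → Matrix (Fin K) (Fin J) ℝ)
    (dem : Node → Fin K → ℝ) : ℝ :=
  sInf {v : ℝ | ∃ x y, capFeas tr A B dem x y ∧ capIntegral x ∧
    (∀ i : Fin I, tr.twoStageConstr (fun n => x n i)) ∧ v = capObj tr a b x y}

/-- `V^{MS}`: optimal value of the multi-stage stochastic capacity expansion problem. -/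
def VMS (tr : ScenarioTree T Node) (a : Node → Fin I → ℝ) (b : Node → Fin J → ℝ)
    (A : Node → Matrix (Fin I) (Fin J) ℝ) (B : Node → Matrix (Fin K) (Fin J) ℝ)
    (dem : Node → Fin K → ℝ) : ℝ :=
  sInf {v : ℝ | ∃ x y, capFeas tr A B dem x y ∧ capIntegral x ∧ v = capObj tr a b x y}

/-- `V^{ATS}(t*)`: optimal value of the adaptive two-stage stochastic capacity
expansion problem under the given vector `t*` of revision times. -/
def VATS (tr : ScenarioTree T Node) (a : Node → Fin I → ℝ) (b : Node → Fin J → ℝ)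
    (A : Node → Matrix (Fin I) (Fin J) ℝ) (B : Node → Matrix (Fin K) (Fin J) ℝ)
    (dem : Node → Fin K → ℝ) (tstar : Fin I → ℕ) : ℝ :=
  sInf {v : ℝ | ∃ x y, capFeas tr A B dem x y ∧ capIntegral x ∧
    (∀ i : Fin I, tr.adaptiveConstr (tstar i) (fun n => x n i)) ∧ v = capObj tr a b x y}

/-- `V^{ATS}`: optimal value of the adaptive two-stage capacity expansion problem in
which the revision times themselves are optimized. -/
def VATSopt (tr : ScenarioTree T Node) (a : Node → Fin I → ℝ) (b : Node → Fin J → ℝ)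
    (A : Node → Matrix (Fin I) (Fin J) ℝ) (B : Node → Matrix (Fin K) (Fin J) ℝ)
    (dem : Node → Fin K → ℝ) : ℝ :=
  sInf {v : ℝ | ∃ tstar : Fin I → ℕ, (∀ i, 1 ≤ tstar i ∧ tstar i ≤ T) ∧
    v = VATS tr a b A B dem tstar}

/-- The merged demand values `δ̂_n = max_{m ∈ Ĉ_n} δ_m` of the condensed scenario tree
`𝒯_i(t*)`: one value for each stage `t < t*` (all stage-`t` nodes are merged) and one
value for each pair of a node `j ∈ S_{t*}` and a stage `t ≥ t*` (the nodes of
`S_t ∩ 𝒯(j)` are merged). -/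
def ScenarioTree.condensedDemands (tr : ScenarioTree T Node) (δ : Node → ℝ)
    (tstar : ℕ) : Set ℝ :=
  {v | ∃ t, 1 ≤ t ∧ t < tstar ∧ v = sSup (δ '' {m | tr.stage m = t})} ∪
  {v | ∃ j, tr.stage j = tstar ∧ ∃ t, tstar ≤ t ∧ t ≤ T ∧
    v = sSup (δ '' {m | tr.stage m = t ∧ tr.onPath j m})}

/-- `max_{n ∈ 𝒯_i(t*)} (⌈δ_{in}⌉ − δ_{in})`: the maximum integrality (ceiling) gap of
the merged demands over the condensed scenario tree. -/
def ScenarioTree.condGap (tr : ScenarioTree T Node) (δ : Node → ℝ) (tstar : ℕ) : ℝ :=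
  sSup ((fun v => (⌈v⌉ : ℝ) - v) '' tr.condensedDemands δ tstar)

end CapacityExpansion

namespace ScenarioTree

variable {T : ℕ} {Node : Type} [Fintype Node] [DecidableEq Node]

theorem onPath_iff' (tr : ScenarioTree T Node) (m n : Node) :
    tr.onPath m n ↔ m = n ∨ tr.onPath m (tr.parent n) := by
  constructor
  · rintro ⟨k, hk⟩
    cases k with
    | zero => left; simpa using hk.symm
    | succ k => right; exact ⟨k, by simpa [Function.iterate_succ_apply] using hk⟩
  · rintro (h | ⟨k, hk⟩)
    · exact ⟨0, by simp [h]⟩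
    · exact ⟨k + 1, by simpa [Function.iterate_succ_apply] using hk⟩

theorem stage_parent_le (tr : ScenarioTree T Node) (n : Node) :
    tr.stage (tr.parent n) ≤ tr.stage n := by
  by_cases h : n = tr.root
  · rw [h, tr.parent_root]
  · have := tr.parent_stage n h
    omega

theorem stage_le_of_onPath (tr : ScenarioTree T Node) {m n : Node} (h : tr.onPath m n) :
    tr.stage m ≤ tr.stage n := by
  obtain ⟨k, hk⟩ := h
  induction k generalizing n with
  | zero => simp at hk; rw [hk]
  | succ k ih =>
    rw [Function.iterate_succ_apply] at hk
    exact (ih hk).trans (tr.stage_parent_le n)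

theorem stage_ind (tr : ScenarioTree T Node) {P : Node → Prop} (h0 : P tr.root)
    (hs : ∀ n, n ≠ tr.root → P (tr.parent n) → P n) (n : Node) : P n := by
  induction hk : tr.stage n using Nat.strong_induction_on generalizing n with
  | _ k ih =>
    by_cases h : n = tr.root
    · rw [h]; exact h0
    · have := tr.parent_stage n h
      exact hs n h (ih _ (by omega) _ rfl)

theorem onPath_root_iff (tr : ScenarioTree T Node) (m : Node) :
    tr.onPath m tr.root ↔ m = tr.root := by
  constructor
  · intro h
    have h1 := tr.stage_le_of_onPath h
    have h2 := tr.stage_pos m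
    rw [tr.stage_root] at h1
    exact tr.root_unique m (by omega)
  · rintro rfl; exact ⟨0, rfl⟩

theorem sum_path_root (tr : ScenarioTree T Node) (x : Node → ℝ) :
    ∑ m ∈ tr.pathSet tr.root, x m = x tr.root := by
  have : tr.pathSet tr.root = {tr.root} := by
    ext m; simp [pathSet, onPath_root_iff]
  rw [this, Finset.sum_singleton]

theorem sum_path_succ (tr : ScenarioTree T Node) (x : Node → ℝ) (n : Node)
    (hn : n ≠ tr.root) :
    ∑ m ∈ tr.pathSet n, x m = x n + ∑ m ∈ tr.pathSet (tr.parent n), x m := by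
  have h : tr.pathSet n = insert n (tr.pathSet (tr.parent n)) := by
    ext m; simp [pathSet, tr.onPath_iff' m n]
  rw [h, Finset.sum_insert]
  intro hm
  simp only [pathSet, Finset.mem_filter, Finset.mem_univ, true_and] at hm
  have h1 := tr.stage_le_of_onPath hm
  have h2 := tr.parent_stage n hn
  omega

theorem exists_anc (tr : ScenarioTree T Node) (t : ℕ) (ht : 1 ≤ t) (n : Node)
    (h : t ≤ tr.stage n) : ∃ j, tr.stage j = t ∧ tr.onPath j n := by
  revert h
  refine tr.stage_ind (P := fun n => t ≤ tr.stage n → ∃ j, tr.stage j = t ∧ tr.onPath j n)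
    ?_ ?_ n
  · intro h
    rw [tr.stage_root] at h
    exact ⟨tr.root, by rw [tr.stage_root]; omega, 0, rfl⟩
  · intro n hn ih h
    by_cases he : tr.stage n = t
    · exact ⟨n, he, 0, rfl⟩
    · have := tr.parent_stage n hn
      obtain ⟨j, h1, h2⟩ := ih (by omega)
      exact ⟨j, h1, (tr.onPath_iff' j n).2 (Or.inr h2)⟩

theorem prob_root (tr : ScenarioTree T Node) : tr.prob tr.root = 1 := by
  have h1 : 1 ≤ T := by
    have := tr.stage_le tr.root
    rwa [tr.stage_root] at this
  have h := tr.prob_sum_stage 1 le_rfl h1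
  have : Finset.univ.filter (fun n => tr.stage n = 1) = {tr.root} := by
    ext m
    simp only [Finset.mem_filter, Finset.mem_univ, true_and, Finset.mem_singleton]
    exact ⟨tr.root_unique m, fun h => by rw [h, tr.stage_root]⟩
  rwa [this, Finset.sum_singleton] at h

/-- Cumulative sums inherit the adaptive constraints. -/
theorem adaptive_cum (tr : ScenarioTree T Node) (t : ℕ) (x : Node → ℝ)
    (h : tr.adaptiveConstr t x) :
    tr.adaptiveConstr t (fun n => ∑ m ∈ tr.pathSet n, x m) := by
  have nr : ∀ m n, tr.stage m = tr.stage n → n ≠ tr.root → m ≠ tr.root := by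
    intro m n hmn hn hm
    apply hn
    apply tr.root_unique
    rw [← hmn, hm, tr.stage_root]
  have root_of : ∀ m, tr.stage m = tr.stage tr.root → m = tr.root := fun m hm =>
    tr.root_unique m (by rw [hm, tr.stage_root])
  refine ⟨?_, ?_⟩
  · intro m n
    refine tr.stage_ind (P := fun n => ∀ m, tr.stage m = tr.stage n → tr.stage m < t →
      ∑ k ∈ tr.pathSet m, x k = ∑ k ∈ tr.pathSet n, x k) ?_ ?_ n m
    · intro m hm _
      rw [root_of m hm]
    · intro n hn ih m hmn hlt
      have hm := nr m n hmn hn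
      have h1 := tr.parent_stage n hn
      have h2 := tr.parent_stage m hm
      rw [tr.sum_path_succ x n hn, tr.sum_path_succ x m hm, h.1 m n hmn hlt,
        ih _ (by omega) (by omega)]
  · intro j hj m n
    refine tr.stage_ind (P := fun n => ∀ m, tr.onPath j m → tr.onPath j n →
      tr.stage m = tr.stage n →
      ∑ k ∈ tr.pathSet m, x k = ∑ k ∈ tr.pathSet n, x k) ?_ ?_ n m
    · intro m _ _ hm
      rw [root_of m hm]
    · intro n hn ih m hjm hjn hmn
      have hm := nr m n hmn hn
      have h1 := tr.parent_stage n hn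
      have h2 := tr.parent_stage m hm
      rcases (tr.onPath_iff' j m).1 hjm with e1 | p1
      · rcases (tr.onPath_iff' j n).1 hjn with e2 | p2
        · rw [← e1, ← e2]
        · have := tr.stage_le_of_onPath p2
          rw [e1] at this
          omega
      · rcases (tr.onPath_iff' j n).1 hjn with e2 | p2
        · have := tr.stage_le_of_onPath p1
          rw [e2] at this
          omega
        · rw [tr.sum_path_succ x n hn, tr.sum_path_succ x m hm, h.2 j hj m n hjm hjn hmn,
            ih _ p1 p2 (by omega)]

theorem bddAbove_image' (δ : Node → ℝ) (s : Set Node) : BddAbove (δ '' s) :=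
  (Set.toFinite _).bddAbove

theorem condGap_nonneg (tr : ScenarioTree T Node) (δ : Node → ℝ) (t : ℕ) :
    0 ≤ tr.condGap δ t := by
  apply Real.sSup_nonneg
  rintro _ ⟨v, _, rfl⟩
  simpa using Int.le_ceil v

theorem le_condGap (tr : ScenarioTree T Node) (δ : Node → ℝ) (t : ℕ) (v : ℝ)
    (hv : v ∈ tr.condensedDemands δ t) : (⌈v⌉ : ℝ) - v ≤ tr.condGap δ t := by
  apply le_csSup
  · refine ⟨1, ?_⟩
    rintro _ ⟨v, _, rfl⟩
    have := Int.ceil_lt_add_one v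
    simp only
    linarith
  · exact ⟨v, hv, rfl⟩

/-- The cumulative capacity plus the gap dominates the rounded up demand. -/
theorem ceil_le_cum (tr : ScenarioTree T Node) (δ x : Node → ℝ) (t : ℕ) (ht : 1 ≤ t)
    (hf : tr.lpFeas δ x) (h : tr.adaptiveConstr t x) (n : Node) :
    (⌈δ n⌉ : ℝ) ≤ ∑ m ∈ tr.pathSet n, x m + tr.condGap δ t := by
  have hc := tr.adaptive_cum t x h
  suffices H : ∃ v ∈ tr.condensedDemands δ t, δ n ≤ v ∧ v ≤ ∑ m ∈ tr.pathSet n, x m by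
    obtain ⟨v, hv, h1, h2⟩ := H
    have h3 := tr.le_condGap δ t v hv
    have h4 : (⌈δ n⌉ : ℝ) ≤ ⌈v⌉ := by exact_mod_cast Int.ceil_le_ceil h1
    linarith
  by_cases hlt : tr.stage n < t
  · refine ⟨_, Or.inl ⟨tr.stage n, tr.stage_pos n, hlt, rfl⟩, ?_, ?_⟩
    · exact le_csSup (bddAbove_image' δ _) ⟨n, rfl, rfl⟩
    · refine csSup_le ⟨δ n, n, rfl, rfl⟩ ?_
      rintro _ ⟨m, hm, rfl⟩
      have hm : tr.stage m = tr.stage n := hm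
      have := hc.1 m n hm (by omega)
      simp only at this
      rw [← this]
      exact hf.2 m
  · obtain ⟨j, hj, hjn⟩ := tr.exists_anc t ht n (by omega)
    refine ⟨_, Or.inr ⟨j, hj, tr.stage n, by omega, tr.stage_le n, rfl⟩, ?_, ?_⟩
    · exact le_csSup (bddAbove_image' δ _) ⟨n, ⟨rfl, hjn⟩, rfl⟩
    · refine csSup_le ⟨δ n, n, ⟨rfl, hjn⟩, rfl⟩ ?_
      rintro _ ⟨m, ⟨hm, hjm⟩, rfl⟩
      have := hc.2 j hj m n hjm hjn hm
      simp only at this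
      rw [← this]
      exact hf.2 m

end ScenarioTree

theorem intervalIntegrable_fract_aux (c a b : ℝ) :
    IntervalIntegrable (fun θ : ℝ => Int.fract (c + θ)) MeasureTheory.volume a b := by
  rw [intervalIntegrable_iff]
  refine MeasureTheory.Measure.integrableOn_of_bounded (M := 1) (by simp) ?_ ?_
  · exact (measurable_fract.comp (measurable_const.add measurable_id)).aestronglyMeasurable
  · refine Filter.Eventually.of_forall fun θ => ?_
    rw [Real.norm_eq_abs, abs_of_nonneg (Int.fract_nonneg _)]
    exact (Int.fract_lt_one _).le

theorem integral_fract_aux (c : ℝ) :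
    ∫ θ in (0:ℝ)..1, Int.fract (c + θ) = ∫ θ in (0:ℝ)..1, Int.fract θ := by
  rw [intervalIntegral.integral_comp_add_left (fun θ => Int.fract θ) c]
  have hp : Function.Periodic (fun θ : ℝ => Int.fract θ) 1 := fun x => Int.fract_add_one x
  have := hp.intervalIntegral_add_eq c 0
  simpa using this

/-- Randomized rounding: some threshold does not increase a linear cost. -/
theorem exists_threshold {ι : Type} [Fintype ι] (w u v : ι → ℝ) :
    ∃ θ : ℝ, 0 ≤ θ ∧ θ < 1 ∧
      ∑ n, w n * ((⌊u n + θ⌋ : ℝ) - ⌊v n + θ⌋) ≤ ∑ n, w n * (u n - v n) := by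
  by_contra hcon
  push Not at hcon
  -- rewrite as positivity of a function with integral zero
  let g : ℝ → ℝ := fun θ => ∑ n, w n * (Int.fract (v n + θ) - Int.fract (u n + θ))
  have hg : ∀ θ, 0 ≤ θ → θ < 1 → 0 < g θ := by
    intro θ h0 h1
    have := hcon θ h0 h1
    have e : g θ = ∑ n, w n * ((⌊u n + θ⌋ : ℝ) - ⌊v n + θ⌋) - ∑ n, w n * (u n - v n) := by
      rw [← Finset.sum_sub_distrib]
      refine Finset.sum_congr rfl fun n _ => ?_
      simp only [Int.fract]
      ring
    rw [e]; linarith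
  have hint : ∀ n, IntervalIntegrable
      (fun θ => w n * (Int.fract (v n + θ) - Int.fract (u n + θ)))
      MeasureTheory.volume 0 1 := fun n =>
    ((intervalIntegrable_fract_aux _ _ _).sub (intervalIntegrable_fract_aux _ _ _)).const_mul _
  have hz : ∫ θ in (0:ℝ)..1, g θ = 0 := by
    simp only [g]
    rw [intervalIntegral.integral_finsetSum (fun n _ => hint n)]
    refine Finset.sum_eq_zero fun n _ => ?_
    rw [intervalIntegral.integral_const_mul,
      intervalIntegral.integral_sub (intervalIntegrable_fract_aux _ _ _)
        (intervalIntegrable_fract_aux _ _ _), integral_fract_aux, integral_fract_aux]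
    simp
  have hgi : IntervalIntegrable g MeasureTheory.volume 0 1 := by
    have := IntervalIntegrable.sum (Finset.univ) (fun n _ => hint n)
    have e : g = ∑ n, fun θ => w n * (Int.fract (v n + θ) - Int.fract (u n + θ)) := by
      funext θ; simp [g]
    rw [e]; exact this
  have hpos := intervalIntegral.intervalIntegral_pos_of_pos_on hgi
    (fun θ hθ => hg θ hθ.1.le hθ.2) one_pos
  linarith

namespace ScenarioTree

variable {T : ℕ} {Node : Type} [Fintype Node] [DecidableEq Node]

/-- Rounding an adaptive LP solution to an integral adaptive solution. -/
theorem exists_rounding (tr : ScenarioTree T Node) (a δ x : Node → ℝ)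
    (t : ℕ) (ht : 1 ≤ t) (hf : tr.lpFeas δ x) (h : tr.adaptiveConstr t x) :
    ∃ z : Node → ℝ, tr.lpFeas δ z ∧ tr.adaptiveConstr t z ∧
      (∀ n, ∃ k : ℕ, z n = (k : ℝ)) ∧
      tr.lpObj a z ≤ tr.lpObj a x + tr.condGap δ t * a tr.root := by
  set G := tr.condGap δ t with hG
  have hG0 : 0 ≤ G := tr.condGap_nonneg δ t
  let e : Node → ℝ := fun n => if n = tr.root then G else 0
  let x' : Node → ℝ := fun n => x n + e n
  have hx'0 : ∀ n, 0 ≤ x' n := by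
    intro n
    have := hf.1 n
    simp only [x', e]
    split_ifs <;> linarith
  have he : tr.adaptiveConstr t e := by
    have : ∀ m n, tr.stage m = tr.stage n → e m = e n := by
      intro m n hmn
      have : m = tr.root ↔ n = tr.root := by
        constructor <;> intro hh <;> apply tr.root_unique
        · rw [← hmn, hh, tr.stage_root]
        · rw [hmn, hh, tr.stage_root]
      simp [e, this]
    exact ⟨fun m n hmn _ => this m n hmn, fun j _ m n _ _ hmn => this m n hmn⟩
  have hx'a : tr.adaptiveConstr t x' :=
    ⟨fun m n h1 h2 => by simp only [x']; rw [h.1 m n h1 h2, he.1 m n h1 h2],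
      fun j hj m n h1 h2 h3 => by
        simp only [x']; rw [h.2 j hj m n h1 h2 h3, he.2 j hj m n h1 h2 h3]⟩
  let X : Node → ℝ := fun n => ∑ m ∈ tr.pathSet n, x' m
  have hXa : tr.adaptiveConstr t X := tr.adaptive_cum t x' hx'a
  have hesum : ∀ n, ∑ m ∈ tr.pathSet n, e m = G := by
    refine tr.stage_ind ?_ ?_
    · rw [tr.sum_path_root]; simp [e]
    · intro n hn ih
      rw [tr.sum_path_succ e n hn, ih]; simp [e, hn]
  have hX : ∀ n, (⌈δ n⌉ : ℝ) ≤ X n := by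
    intro n
    simp only [X, x']
    rw [Finset.sum_add_distrib, hesum]
    exact tr.ceil_le_cum δ x t ht hf h n
  obtain ⟨θ, h0, h1, hθ⟩ := exists_threshold (fun n => tr.prob n * a n) X (fun n => X n - x' n)
  let z : Node → ℝ := fun n => (⌊X n + θ⌋ : ℝ) - ⌊X n - x' n + θ⌋
  have hXroot : X tr.root = x' tr.root := tr.sum_path_root x'
  have hXs : ∀ n, n ≠ tr.root → X n - x' n = X (tr.parent n) := by
    intro n hn
    have := tr.sum_path_succ x' n hn
    simp only [X]; linarith
  have hzsum : ∀ n, ∑ m ∈ tr.pathSet n, z m = ⌊X n + θ⌋ := by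
    refine tr.stage_ind ?_ ?_
    · rw [tr.sum_path_root]
      have : ⌊θ⌋ = 0 := Int.floor_eq_zero_iff.2 ⟨h0, h1⟩
      simp [z, hXroot, this]
    · intro n hn ih
      rw [tr.sum_path_succ z n hn, ih]
      simp only [z]
      rw [hXs n hn]; ring
  have hle : ∀ n, ⌊X n - x' n + θ⌋ ≤ ⌊X n + θ⌋ := fun n =>
    Int.floor_le_floor (by linarith [hx'0 n])
  refine ⟨z, ⟨?_, ?_⟩, ⟨?_, ?_⟩, ?_, ?_⟩
  · intro n
    have : ((⌊X n - x' n + θ⌋ : ℤ) : ℝ) ≤ ⌊X n + θ⌋ := by exact_mod_cast hle n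
    simp only [z]; linarith
  · intro n
    rw [hzsum n]
    have h2 : ⌈δ n⌉ ≤ ⌊X n + θ⌋ := Int.le_floor.2 (by linarith [hX n])
    have h3 : (⌈δ n⌉ : ℝ) ≤ ⌊X n + θ⌋ := by exact_mod_cast h2
    exact (Int.le_ceil _).trans h3
  · intro m n h2 h3
    simp only [z]
    rw [hXa.1 m n h2 h3, hx'a.1 m n h2 h3]
  · intro j hj m n h2 h3 h4
    simp only [z]
    rw [hXa.2 j hj m n h2 h3 h4, hx'a.2 j hj m n h2 h3 h4]
  · intro n
    refine ⟨(⌊X n + θ⌋ - ⌊X n - x' n + θ⌋).toNat, ?_⟩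
    have h2 := Int.toNat_of_nonneg (sub_nonneg.2 (hle n))
    have h3 : (((⌊X n + θ⌋ - ⌊X n - x' n + θ⌋).toNat : ℤ) : ℝ)
        = ((⌊X n + θ⌋ - ⌊X n - x' n + θ⌋ : ℤ) : ℝ) := by rw [h2]
    simp only [z]
    rw [Int.cast_natCast] at h3
    rw [h3]; push_cast; ring
  · have e1 : ∑ n, tr.prob n * a n * (X n - (X n - x' n))
        = tr.lpObj a x + G * a tr.root := by
      simp only [sub_sub_cancel, x', mul_add, Finset.sum_add_distrib, lpObj]
      congr 1
      simp [e, tr.prob_root, mul_comm]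
    rw [← e1]
    exact hθ

theorem lpObj_nonneg (tr : ScenarioTree T Node) (a x : Node → ℝ) (ha : ∀ n, 0 ≤ a n)
    (hx : ∀ n, 0 ≤ x n) : 0 ≤ tr.lpObj a x :=
  Finset.sum_nonneg fun n _ => mul_nonneg (mul_nonneg (tr.prob_pos n).le (ha n)) (hx n)

theorem exists_adaptive (tr : ScenarioTree T Node) (δ : Node → ℝ) (t : ℕ) :
    ∃ x, tr.lpFeas δ x ∧ tr.adaptiveConstr t x := by
  let M : ℝ := ∑ n, |δ n|
  have hM : ∀ n, δ n ≤ M := fun n => (le_abs_self _).trans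
    (Finset.single_le_sum (f := fun n => |δ n|) (fun _ _ => abs_nonneg _) (Finset.mem_univ n))
  have hM0 : 0 ≤ M := Finset.sum_nonneg fun _ _ => abs_nonneg _
  refine ⟨fun _ => M, ⟨fun _ => hM0, fun n => ?_⟩, fun _ _ _ _ => rfl, fun _ _ _ _ _ _ _ => rfl⟩
  refine (hM n).trans (Finset.single_le_sum (f := fun _ => M) (a := n) (fun _ _ => hM0) ?_)
  simp only [pathSet, Finset.mem_filter, Finset.mem_univ, true_and]
  exact ⟨0, rfl⟩

theorem exists_integral (tr : ScenarioTree T Node) (a δ : Node → ℝ) (ha : ∀ n, 0 ≤ a n)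
    (t : ℕ) (ht : 1 ≤ t) (ε : ℝ) (hε : 0 < ε) :
    ∃ z : Node → ℝ, tr.lpFeas δ z ∧ tr.adaptiveConstr t z ∧
      (∀ n, ∃ k : ℕ, z n = (k : ℝ)) ∧
      tr.lpObj a z ≤ tr.vR a δ t + tr.condGap δ t * a tr.root + ε := by
  obtain ⟨x0, hx0⟩ := tr.exists_adaptive δ t
  obtain ⟨_, ⟨x, hx, rfl⟩, hlt⟩ := exists_lt_of_csInf_lt
    (s := tr.lpObj a '' {x | tr.lpFeas δ x ∧ tr.adaptiveConstr t x}) ⟨_, x0, hx0, rfl⟩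
    (lt_add_of_pos_right _ hε)
  obtain ⟨z, h1, h2, h3, h4⟩ := tr.exists_rounding a δ x t ht hx.1 hx.2
  refine ⟨z, h1, h2, h3, h4.trans ?_⟩
  have : tr.lpObj a x < tr.vR a δ t + ε := hlt
  linarith

theorem vM_le (tr : ScenarioTree T Node) (a δ x : Node → ℝ) (ha : ∀ n, 0 ≤ a n)
    (hx : tr.lpFeas δ x) : tr.vM a δ ≤ tr.lpObj a x := by
  refine csInf_le ⟨0, ?_⟩ ⟨x, hx, rfl⟩
  rintro _ ⟨w, hw, rfl⟩
  exact tr.lpObj_nonneg a w ha hw.1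

end ScenarioTree

theorem capObj_eq {T : ℕ} {Node : Type} [Fintype Node] [DecidableEq Node] {I J : ℕ}
    (tr : ScenarioTree T Node) (a : Node → Fin I → ℝ) (b : Node → Fin J → ℝ)
    (x : Node → Fin I → ℝ) (y : Node → Fin J → ℝ) :
    capObj tr a b x y = ∑ i, tr.lpObj (fun n => a n i) (fun n => x n i)
      + ∑ n, tr.prob n * ∑ j, b n j * y n j := by
  simp only [capObj, mul_add, Finset.sum_add_distrib, ScenarioTree.lpObj]
  congr 1
  rw [Finset.sum_comm]
  refine Finset.sum_congr rfl fun n _ => ?_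
  rw [Finset.mul_sum]
  exact Finset.sum_congr rfl fun i _ => by ring

theorem capObj_nonneg {T : ℕ} {Node : Type} [Fintype Node] [DecidableEq Node] {I J K : ℕ}
    (tr : ScenarioTree T Node) (a : Node → Fin I → ℝ) (b : Node → Fin J → ℝ)
    (A : Node → Matrix (Fin I) (Fin J) ℝ) (B : Node → Matrix (Fin K) (Fin J) ℝ)
    (dem : Node → Fin K → ℝ)
    (ha : ∀ n i, 0 ≤ a n i) (hb : ∀ n j, 0 ≤ b n j)
    (x : Node → Fin I → ℝ) (y : Node → Fin J → ℝ) (h : capFeas tr A B dem x y) :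
    0 ≤ capObj tr a b x y :=
  Finset.sum_nonneg fun n _ => mul_nonneg (tr.prob_pos n).le (add_nonneg
    (Finset.sum_nonneg fun i _ => mul_nonneg (ha n i) (h.1 n i))
    (Finset.sum_nonneg fun j _ => mul_nonneg (hb n j) (h.2.1 n j)))

/-- **Proposition 10**: if `y^{MLP}` is an optimal capacity allocation of the LP
relaxation of the multi-stage capacity expansion problem and `δ_{in} = [A_n y^{MLP}_n]_i`,
then for any revision vector `t*`,
`V^{ATS}(t*) − V^{MS} ≤ ∑_i (v_i^R(t_i*) − v_i^M + max_{n ∈ 𝒯_i(t_i*)}(⌈δ_{in}⌉ − δ_{in}) a_{i1})`. -/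
theorem VATS_sub_VMS_upper_bound
    {T : ℕ} {Node : Type} [Fintype Node] [DecidableEq Node] {I J K : ℕ}
    (tr : ScenarioTree T Node)
    (a : Node → Fin I → ℝ) (b : Node → Fin J → ℝ)
    (A : Node → Matrix (Fin I) (Fin J) ℝ) (B : Node → Matrix (Fin K) (Fin J) ℝ)
    (dem : Node → Fin K → ℝ)
    (ha : ∀ n i, 0 ≤ a n i) (hb : ∀ n j, 0 ≤ b n j)
    (hA : ∀ n i j, 0 ≤ A n i j) (hB : ∀ n k j, 0 ≤ B n k j)
    (hdem : ∀ n k, 0 ≤ dem n k)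
    (xMLP : Node → Fin I → ℝ) (yMLP : Node → Fin J → ℝ)
    (hfeas : capFeas tr A B dem xMLP yMLP)
    (hopt : capObj tr a b xMLP yMLP =
      sInf {v : ℝ | ∃ x y, capFeas tr A B dem x y ∧ v = capObj tr a b x y})
    (tstar : Fin I → ℕ) (htstar : ∀ i, 1 ≤ tstar i ∧ tstar i ≤ T) :
    VATS tr a b A B dem tstar - VMS tr a b A B dem
      ≤ ∑ i : Fin I,
        (tr.vR (fun n => a n i) (fun n => (A n).mulVec (yMLP n) i) (tstar i)
          - tr.vM (fun n => a n i) (fun n => (A n).mulVec (yMLP n) i)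
          + tr.condGap (fun n => (A n).mulVec (yMLP n) i) (tstar i) * a tr.root i) := by
  have key : ∀ ε : ℝ, 0 < ε → ∃ z : Node → Fin I → ℝ, capFeas tr A B dem z yMLP ∧
      capIntegral z ∧ (∀ i : Fin I, tr.adaptiveConstr (tstar i) (fun n => z n i)) ∧
      ∀ i, tr.lpObj (fun n => a n i) (fun n => z n i) ≤
        tr.vR (fun n => a n i) (fun n => (A n).mulVec (yMLP n) i) (tstar i)
          + tr.condGap (fun n => (A n).mulVec (yMLP n) i) (tstar i) * a tr.root i + ε := by
    intro ε hε
    choose z h1 h2 h3 h4 using fun i : Fin I =>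
      tr.exists_integral (fun n => a n i) (fun n => (A n).mulVec (yMLP n) i)
        (fun n => ha n i) (tstar i) (htstar i).1 ε hε
    exact ⟨fun n i => z i n, ⟨fun n i => (h1 i).1 n, hfeas.2.1, fun n i => (h1 i).2 n,
      hfeas.2.2.2⟩, fun n i => h3 i n, h2, h4⟩
  set β : ℝ := ∑ n, tr.prob n * ∑ j, b n j * yMLP n j with hβ
  have hMS : ∑ i, tr.vM (fun n => a n i) (fun n => (A n).mulVec (yMLP n) i) + β
      ≤ VMS tr a b A B dem := by
    have h1 : ∑ i, tr.vM (fun n => a n i) (fun n => (A n).mulVec (yMLP n) i) + β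
        ≤ capObj tr a b xMLP yMLP := by
      rw [capObj_eq]
      gcongr with i
      exact tr.vM_le _ _ _ (fun n => ha n i) ⟨fun n => hfeas.1 n i, fun n => hfeas.2.2.1 n i⟩
    refine h1.trans ?_
    obtain ⟨z, hz, hzi, _, _⟩ := key 1 one_pos
    refine le_csInf ⟨_, z, yMLP, hz, hzi, rfl⟩ ?_
    rintro _ ⟨x, y, hxy, _, rfl⟩
    rw [hopt]
    refine csInf_le ⟨0, ?_⟩ ⟨x, y, hxy, rfl⟩
    rintro _ ⟨x, y, hxy, rfl⟩
    exact capObj_nonneg tr a b A B dem ha hb x y hxy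
  have hATS : ∀ ε : ℝ, 0 < ε → VATS tr a b A B dem tstar ≤
      (∑ i, (tr.vR (fun n => a n i) (fun n => (A n).mulVec (yMLP n) i) (tstar i)
          + tr.condGap (fun n => (A n).mulVec (yMLP n) i) (tstar i) * a tr.root i) + β) + ε := by
    intro ε hε
    have hI : (0:ℝ) < (I:ℝ) + 1 := by positivity
    obtain ⟨z, hz, hzi, hza, hzo⟩ := key (ε / ((I:ℝ) + 1)) (div_pos hε hI)
    have h1 : VATS tr a b A B dem tstar ≤ capObj tr a b z yMLP := by
      refine csInf_le ⟨0, ?_⟩ ⟨z, yMLP, hz, hzi, hza, rfl⟩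
      rintro _ ⟨x, y, hxy, _, _, rfl⟩
      exact capObj_nonneg tr a b A B dem ha hb x y hxy
    rw [capObj_eq] at h1
    have h2 := Finset.sum_le_sum (s := Finset.univ) fun i _ => hzo i
    rw [Finset.sum_add_distrib, Finset.sum_const, Finset.card_univ, Fintype.card_fin,
      nsmul_eq_mul] at h2
    have h3 : (I:ℝ) * (ε / ((I:ℝ) + 1)) ≤ ε := by
      rw [mul_div_assoc', div_le_iff₀ hI]
      nlinarith
    linarith
  have h := le_of_forall_pos_le_add hATS
  simp only [Finset.sum_add_distrib, Finset.sum_sub_distrib] at h ⊢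
  linarith
end
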